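/- Let 0 ≤ α < n, 0 < t < ∞, 1 < p < r < ∞ and 1 < q < s < ∞ with α/n = 1/p − 1/r = 1/q − 1/s. Then there exists a constant C, independent of t, such that for every f ∈ (E_p^q)_t(ℝ^n), ‖M_α f‖_{(E_r^s)_t} ≤ C ‖f‖_{(E_p^q)_t}. -/

import Mathlib

open MeasureTheory ENNReal Metric

noncomputable section

/-- The (closed) cube centered at `x` with side length `r`. -/
def cube {n : ℕ} (x : EuclideanSpace ℝ (Fin n)) (r : ℝ) : Set (EuclideanSpace ℝ (Fin n)) :=
  {y | ∀ i, |y i - x i| ≤ r / 2}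

/-- The average `f_Q = |Q|⁻¹ ∫_Q f` of `f` over a set `Q`. -/
def setAvg {n : ℕ} (Q : Set (EuclideanSpace ℝ (Fin n))) (f : EuclideanSpace ℝ (Fin n) → ℝ) : ℝ :=
  (volume Q).toReal⁻¹ * ∫ y in Q, f y

/-- Slice norm of an `ℝ≥0∞`-valued function. -/
def sliceNormE {n : ℕ} (p q t : ℝ) (g : EuclideanSpace ℝ (Fin n) → ℝ≥0∞) : ℝ≥0∞ :=
  (∫⁻ x, ((volume (cube x t))⁻¹ * ∫⁻ y in cube x t, g y ^ p) ^ (q / p)) ^ (1 / q)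

/-- The slice space norm `‖f‖_{(E_p^q)_t}`. -/
def sliceNorm {n : ℕ} (p q t : ℝ) (f : EuclideanSpace ℝ (Fin n) → ℝ) : ℝ≥0∞ :=
  sliceNormE p q t fun y => ENNReal.ofReal |f y|

/-- Membership in the slice space `(E_p^q)_t(ℝⁿ)`. -/
def MemSlice {n : ℕ} (p q t : ℝ) (f : EuclideanSpace ℝ (Fin n) → ℝ) : Prop :=
  Measurable f ∧ sliceNorm p q t f ≠ ∞

/-- The BMO seminorm, as a supremum over all cubes. -/
def bmoNorm {n : ℕ} (b : EuclideanSpace ℝ (Fin n) → ℝ) : ℝ≥0∞ :=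
  ⨆ (x : EuclideanSpace ℝ (Fin n)) (r : ℝ) (_ : 0 < r),
    (volume (cube x r))⁻¹ * ∫⁻ y in cube x r, ENNReal.ofReal |b y - setAvg (cube x r) b|

/-- Membership in `BMO(ℝⁿ)`. -/
def MemBMO {n : ℕ} (b : EuclideanSpace ℝ (Fin n) → ℝ) : Prop :=
  LocallyIntegrable b volume ∧ bmoNorm b ≠ ∞

/-- `Ω` is homogeneous of degree zero. -/
def HomogZero {n : ℕ} (Ω : EuclideanSpace ℝ (Fin n) → ℝ) : Prop :=
  ∀ lam : ℝ, 0 < lam → ∀ x : EuclideanSpace ℝ (Fin n), x ≠ 0 → Ω (lam • x) = Ω x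

/-- `Ω` has mean value zero on the unit sphere. -/
def MeanZeroOnSphere {n : ℕ} (Ω : EuclideanSpace ℝ (Fin n) → ℝ) : Prop :=
  ∫ x : sphere (0 : EuclideanSpace ℝ (Fin n)) 1, Ω x
    ∂((volume : Measure (EuclideanSpace ℝ (Fin n))).toSphere) = 0

/-- The fractional integral operator with rough kernel,
`T_{Ω,α} f (x) = ∫ Ω(x-y) |x-y|^{α-n} f(y) dy`. -/
def fracInt {n : ℕ} (Ω : EuclideanSpace ℝ (Fin n) → ℝ) (α : ℝ)
    (f : EuclideanSpace ℝ (Fin n) → ℝ) (x : EuclideanSpace ℝ (Fin n)) : ℝ :=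
  ∫ y, Ω (x - y) * ‖x - y‖ ^ (α - n) * f y

/-- The commutator `[b, T_{Ω,α}] f = b ⬝ T_{Ω,α} f - T_{Ω,α}(b f)`. -/
def commutatorOp {n : ℕ} (Ω : EuclideanSpace ℝ (Fin n) → ℝ) (α : ℝ)
    (b f : EuclideanSpace ℝ (Fin n) → ℝ) : EuclideanSpace ℝ (Fin n) → ℝ :=
  fun x => b x * fracInt Ω α f x - fracInt Ω α (fun y => b y * f y) x

/-- The fractional maximal operator `M_γ` (over cubes); `γ = 0` gives the
Hardy–Littlewood maximal operator. -/
def fracMax {n : ℕ} (γ : ℝ) (f : EuclideanSpace ℝ (Fin n) → ℝ)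
    (x : EuclideanSpace ℝ (Fin n)) : ℝ≥0∞ :=
  ⨆ (z : EuclideanSpace ℝ (Fin n)) (r : ℝ) (_ : 0 < r) (_ : x ∈ cube z r),
    volume (cube z r) ^ (γ / n - 1) * ∫⁻ y in cube z r, ENNReal.ofReal |f y|

/-- The Fefferman–Stein sharp maximal operator `M^♯`. -/
def sharpMax {n : ℕ} (f : EuclideanSpace ℝ (Fin n) → ℝ)
    (x : EuclideanSpace ℝ (Fin n)) : ℝ≥0∞ :=
  ⨆ (z : EuclideanSpace ℝ (Fin n)) (r : ℝ) (_ : 0 < r) (_ : x ∈ cube z r),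
    (volume (cube z r))⁻¹ * ∫⁻ y in cube z r, ENNReal.ofReal |f y - setAvg (cube z r) f|

/-- The `L^p` norm. -/
def lpNorm {n : ℕ} (p : ℝ) (f : EuclideanSpace ℝ (Fin n) → ℝ) : ℝ≥0∞ :=
  (∫⁻ x, ENNReal.ofReal |f x| ^ p) ^ (1 / p)

/-- The set of admissible Hölder–Lipschitz constants of order `β` for `b`. -/
def LipConstSet {n : ℕ} (β : ℝ) (b : EuclideanSpace ℝ (Fin n) → ℝ) : Set ℝ :=
  {C : ℝ | ∀ x y, |b x - b y| ≤ C * dist x y ^ β}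

/-- Membership in the Lipschitz space `Lip_β(ℝⁿ)`. -/
def MemLip {n : ℕ} (β : ℝ) (b : EuclideanSpace ℝ (Fin n) → ℝ) : Prop :=
  (LipConstSet β b).Nonempty

/-- The `Lip_β` norm: the least admissible constant. -/
def lipNorm {n : ℕ} (β : ℝ) (b : EuclideanSpace ℝ (Fin n) → ℝ) : ℝ :=
  sInf (LipConstSet β b)

/-- Pointwise layer cake formula for extended nonnegative numbers. -/
theorem rpow_eq_lintegral_layer (a : ℝ≥0∞) {p : ℝ} (hp : 0 < p) :
    a ^ p = ENNReal.ofReal p * ∫⁻ t in Set.Ioi (0 : ℝ),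
      {t : ℝ | ENNReal.ofReal t < a}.indicator (fun t => ENNReal.ofReal (t ^ (p - 1))) t := by
  have key : ∀ b : ℝ, 0 ≤ b → ENNReal.ofReal b ^ p = ENNReal.ofReal p *
      ∫⁻ t in Set.Ioi (0 : ℝ), {t : ℝ | ENNReal.ofReal t < ENNReal.ofReal b}.indicator
        (fun t => ENNReal.ofReal (t ^ (p - 1))) t := by
    intro b hb
    have h := lintegral_rpow_eq_lintegral_meas_lt_mul (Measure.dirac ()) (f := fun _ => b)
      (.of_forall fun _ => hb) aemeasurable_const hp
    rw [ENNReal.ofReal_rpow_of_nonneg hb hp.le]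
    simp only [lintegral_dirac] at h
    rw [h]
    congr 1
    refine setLIntegral_congr_fun measurableSet_Ioi fun t ht => ?_
    by_cases htb : t < b
    · have : ENNReal.ofReal t < ENNReal.ofReal b :=
        (ENNReal.ofReal_lt_ofReal_iff_of_nonneg (le_of_lt ht)).2 htb
      simp [Set.indicator, htb, this]
    · have : ¬ ENNReal.ofReal t < ENNReal.ofReal b := fun h' =>
        htb ((ENNReal.ofReal_lt_ofReal_iff_of_nonneg (le_of_lt ht)).1 h')
      simp [Set.indicator, htb, this]
  rcases eq_or_ne a ∞ with rfl | ha
  · rw [ENNReal.top_rpow_of_pos hp]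
    refine (ENNReal.eq_top_of_forall_nnreal_le fun r => ?_).symm
    have h1 := key ((r : ℝ) ^ (1 / p)) (by positivity)
    rw [ENNReal.ofReal_rpow_of_nonneg (by positivity) hp.le, ← Real.rpow_mul r.coe_nonneg,
      one_div_mul_cancel hp.ne', Real.rpow_one, ENNReal.ofReal_coe_nnreal] at h1
    rw [h1]
    gcongr
    exact le_top
  · have := key a.toReal ENNReal.toReal_nonneg
    rwa [ENNReal.ofReal_toReal ha] at this

/-- A weak type estimate with truncation implies a strong type estimate. -/
theorem lintegral_rpow_le_of_truncated_weak {X : Type*} [MeasurableSpace X] {μ : Measure X}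
    [SFinite μ] {h m : X → ℝ≥0∞} (hh : Measurable h) (hm : Measurable m) {p : ℝ} (hp : 1 < p)
    (C : ℝ≥0∞)
    (hw : ∀ t : ℝ, 0 < t → ENNReal.ofReal t * μ {x | ENNReal.ofReal t < m x} ≤
      C * ∫⁻ x, {x | ENNReal.ofReal t < 2 * h x}.indicator h x ∂μ) :
    ∫⁻ x, m x ^ p ∂μ ≤
      ENNReal.ofReal p * (C * ((ENNReal.ofReal (p - 1))⁻¹ * 2 ^ (p - 1))) * ∫⁻ x, h x ^ p ∂μ := by
  have hp0 : 0 < p := by linarith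
  have hp1 : 0 < p - 1 := by linarith
  have meas1 : Measurable (fun z : X × ℝ => {t : ℝ | ENNReal.ofReal t < m z.1}.indicator
      (fun t => ENNReal.ofReal (t ^ (p - 1))) z.2) := by
    have : (fun z : X × ℝ => {t : ℝ | ENNReal.ofReal t < m z.1}.indicator
      (fun t => ENNReal.ofReal (t ^ (p - 1))) z.2) =
      {z : X × ℝ | ENNReal.ofReal z.2 < m z.1}.indicator
        (fun z => ENNReal.ofReal (z.2 ^ (p - 1))) := by
      ext z; simp [Set.indicator]
    rw [this]
    refine Measurable.indicator (by fun_prop) ?_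
    exact measurableSet_lt (by fun_prop) (by fun_prop)
  have meas2 : Measurable (fun z : X × ℝ => {t : ℝ | ENNReal.ofReal t < 2 * h z.1}.indicator
      (fun t => ENNReal.ofReal (t ^ (p - 1 - 1))) z.2) := by
    have : (fun z : X × ℝ => {t : ℝ | ENNReal.ofReal t < 2 * h z.1}.indicator
      (fun t => ENNReal.ofReal (t ^ (p - 1 - 1))) z.2) =
      {z : X × ℝ | ENNReal.ofReal z.2 < 2 * h z.1}.indicator
        (fun z => ENNReal.ofReal (z.2 ^ (p - 1 - 1))) := by
      ext z; simp [Set.indicator]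
    rw [this]
    refine Measurable.indicator (by fun_prop) ?_
    exact measurableSet_lt (by fun_prop) (by fun_prop)
  calc ∫⁻ x, m x ^ p ∂μ
      = ENNReal.ofReal p * ∫⁻ x, (∫⁻ t in Set.Ioi (0 : ℝ),
        {t : ℝ | ENNReal.ofReal t < m x}.indicator
          (fun t => ENNReal.ofReal (t ^ (p - 1))) t) ∂μ := by
        rw [← lintegral_const_mul _ meas1.lintegral_prod_right]
        exact lintegral_congr fun x => rpow_eq_lintegral_layer _ hp0
    _ = ENNReal.ofReal p * ∫⁻ t in Set.Ioi (0 : ℝ), ∫⁻ x,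
        {t : ℝ | ENNReal.ofReal t < m x}.indicator
          (fun t => ENNReal.ofReal (t ^ (p - 1))) t ∂μ := by
        rw [lintegral_lintegral_swap meas1.aemeasurable]
    _ ≤ ENNReal.ofReal p * ∫⁻ t in Set.Ioi (0 : ℝ), C * ∫⁻ x, h x *
        {t : ℝ | ENNReal.ofReal t < 2 * h x}.indicator
          (fun t => ENNReal.ofReal (t ^ (p - 1 - 1))) t ∂μ := by
        gcongr 1
        refine setLIntegral_mono' measurableSet_Ioi fun t ht => ?_
        have ht : 0 < t := ht
        have e1 : ENNReal.ofReal (t ^ (p - 1)) =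
            ENNReal.ofReal (t ^ (p - 1 - 1)) * ENNReal.ofReal t := by
          rw [← ENNReal.ofReal_mul (by positivity), ← Real.rpow_add_one ht.ne']
          congr 2; ring
        have e2 : ∫⁻ x, {t : ℝ | ENNReal.ofReal t < m x}.indicator
            (fun t => ENNReal.ofReal (t ^ (p - 1))) t ∂μ =
            ENNReal.ofReal (t ^ (p - 1)) * μ {x | ENNReal.ofReal t < m x} := by
          rw [← lintegral_indicator_const (measurableSet_lt measurable_const hm)]
          exact lintegral_congr fun x => by simp [Set.indicator]
        have e3 : ∫⁻ x, h x * {t : ℝ | ENNReal.ofReal t < 2 * h x}.indicator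
            (fun t => ENNReal.ofReal (t ^ (p - 1 - 1))) t ∂μ =
            ENNReal.ofReal (t ^ (p - 1 - 1)) *
              ∫⁻ x, {x | ENNReal.ofReal t < 2 * h x}.indicator h x ∂μ := by
          rw [← lintegral_const_mul _ (hh.indicator
            (measurableSet_lt measurable_const (by fun_prop)))]
          refine lintegral_congr fun x => ?_
          simp [Set.indicator, mul_comm]
        rw [e2, e3, e1, mul_assoc, mul_left_comm C]
        gcongr 1
        exact hw t ht
    _ = ENNReal.ofReal p * (C * ∫⁻ x, (h x * ∫⁻ t in Set.Ioi (0 : ℝ),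
        {t : ℝ | ENNReal.ofReal t < 2 * h x}.indicator
          (fun t => ENNReal.ofReal (t ^ (p - 1 - 1))) t) ∂μ) := by
        have meas3 : Measurable (fun z : X × ℝ => h z.1 *
          {t : ℝ | ENNReal.ofReal t < 2 * h z.1}.indicator
            (fun t => ENNReal.ofReal (t ^ (p - 1 - 1))) z.2) :=
          (hh.comp measurable_fst).mul meas2
        rw [lintegral_const_mul _ meas3.lintegral_prod_left',
          ← lintegral_lintegral_swap meas3.aemeasurable]
        congr 2
        refine lintegral_congr fun x => ?_
        exact lintegral_const_mul (h x) (meas2.comp (measurable_prodMk_left (x := x)))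
    _ = ENNReal.ofReal p * (C * ∫⁻ x, (ENNReal.ofReal (p - 1))⁻¹ * 2 ^ (p - 1) * h x ^ p ∂μ) := by
        congr 2
        refine lintegral_congr fun x => ?_
        have e := rpow_eq_lintegral_layer (2 * h x) hp1
        have hc : ENNReal.ofReal (p - 1) ≠ 0 := by simpa using hp
        have e' : ∫⁻ t in Set.Ioi (0 : ℝ), {t : ℝ | ENNReal.ofReal t < 2 * h x}.indicator
            (fun t => ENNReal.ofReal (t ^ (p - 1 - 1))) t =
            (ENNReal.ofReal (p - 1))⁻¹ * (2 * h x) ^ (p - 1) := by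
          rw [e, ← mul_assoc, ENNReal.inv_mul_cancel hc ENNReal.ofReal_ne_top, one_mul]
        have e4 : h x ^ p = h x * h x ^ (p - 1) := by
          conv_rhs => rw [← ENNReal.rpow_one (h x), ← ENNReal.rpow_mul,
            ← ENNReal.rpow_add_of_nonneg _ _ zero_le_one (by linarith)]
          congr 1; ring
        rw [e', ENNReal.mul_rpow_of_nonneg _ _ hp1.le, e4]
        ring
    _ = _ := by
        rw [lintegral_const_mul _ (by fun_prop)]
        ring


/-- A noncentered Hardy–Littlewood maximal function over balls: the average over
`closedBall z R` is tested at all points of the larger open ball `ball z (2 * R)`. -/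
def ballMax {E : Type*} [PseudoMetricSpace E] [MeasurableSpace E]
    (μ : Measure E) (h : E → ℝ≥0∞) (x : E) : ℝ≥0∞ :=
  ⨆ (z : E) (R : ℝ) (_ : 0 < R), (ball z (2 * R)).indicator
    (fun _ => (μ (closedBall z R))⁻¹ * ∫⁻ y in closedBall z R, h y ∂μ) x

theorem measurable_ballMax {E : Type*} [PseudoMetricSpace E] [MeasurableSpace E] [BorelSpace E]
    (μ : Measure E) (h : E → ℝ≥0∞) : Measurable (ballMax μ h) := by
  refine LowerSemicontinuous.measurable ?_
  refine lowerSemicontinuous_iSup fun z => lowerSemicontinuous_iSup fun R =>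
    lowerSemicontinuous_iSup fun _ => isOpen_ball.lowerSemicontinuous_indicator (zero_le)

section Ball

variable {E : Type*} [NormedAddCommGroup E] [NormedSpace ℝ E] [FiniteDimensional ℝ E]
  [MeasurableSpace E] [BorelSpace E]

variable (μ : Measure E) [μ.IsAddHaarMeasure]

theorem ballMax_weak [Nontrivial E] (h : E → ℝ≥0∞) (c : ℝ≥0∞) :
    c * μ {x | c < ballMax μ h x} ≤ ENNReal.ofReal (8 ^ Module.finrank ℝ E) * ∫⁻ x, h x ∂μ := by
  rcases eq_or_ne c 0 with rfl | hc0
  · simp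
  rcases eq_or_ne c ∞ with rfl | hct
  · simp
  rcases eq_or_ne (∫⁻ x, h x ∂μ) ∞ with hI | hI
  · rw [hI, ENNReal.mul_top (by simp)]; exact le_top
  set d := Module.finrank ℝ E with hd
  have hd0 : d ≠ 0 := (Module.finrank_pos (R := ℝ) (M := E)).ne'
  set S : Set (E × ℝ) := {a | 0 < a.2 ∧
    c * μ (closedBall a.1 a.2) ≤ ∫⁻ y in closedBall a.1 a.2, h y ∂μ} with hS
  have hb0 : μ (ball 0 1) ≠ 0 := (measure_ball_pos μ 0 one_pos).ne'
  have hbt : μ (ball 0 1) ≠ ∞ := measure_ball_lt_top.ne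
  obtain ⟨K, hK⟩ : ∃ K : ℝ, ∀ a ∈ S, 2 * a.2 ≤ K := by
    set B := ((∫⁻ x, h x ∂μ) / (c * μ (ball 0 1))).toReal with hB
    refine ⟨2 * max 1 B, fun a ha => ?_⟩
    have h1 : c * μ (closedBall a.1 a.2) ≤ ∫⁻ x, h x ∂μ := ha.2.trans (setLIntegral_le_lintegral _ _)
    rw [Measure.addHaar_closedBall μ _ ha.1.le] at h1
    have h2 : ENNReal.ofReal (a.2 ^ d) ≤ (∫⁻ x, h x ∂μ) / (c * μ (ball 0 1)) := by
      rw [ENNReal.le_div_iff_mul_le (.inl (mul_ne_zero hc0 hb0)) (.inl (ENNReal.mul_ne_top hct hbt))]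
      convert h1 using 1; ring
    have h3 : a.2 ^ d ≤ B := by
      refine (ENNReal.ofReal_le_iff_le_toReal ?_).1 h2
      exact ENNReal.div_ne_top hI (mul_ne_zero hc0 hb0)
    have h4 : a.2 ≤ max 1 B := by
      rcases le_total a.2 1 with h | h
      · exact h.trans (le_max_left _ _)
      · exact ((le_self_pow₀ h hd0).trans h3).trans (le_max_right _ _)
    linarith
  obtain ⟨u, huS, hdisj, hcov⟩ := Vitali.exists_disjoint_subfamily_covering_enlargement_closedBall
    S (fun a => a.1) (fun a => 2 * a.2) K hK 4 (by norm_num)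
  have hucount : u.Countable := by
    refine hdisj.countable_of_nonempty_interior fun a ha => ?_
    refine ⟨a.1, ball_subset_interior_closedBall (mem_ball_self ?_)⟩
    have := (huS ha).1
    positivity
  have hsub : {x | c < ballMax μ h x} ⊆ ⋃ a ∈ u, closedBall a.1 (8 * a.2) := by
    intro x hx
    simp only [Set.mem_ofPred_eq, ballMax, lt_iSup_iff] at hx
    obtain ⟨z, R, hR, hx⟩ := hx
    by_cases hxb : x ∈ ball z (2 * R)
    · rw [Set.indicator_of_mem hxb] at hx
      have hm0 : μ (closedBall z R) ≠ 0 := (measure_closedBall_pos μ z hR).ne'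
      have hmt : μ (closedBall z R) ≠ ∞ := measure_closedBall_lt_top.ne
      have ha : (z, R) ∈ S := by
        refine ⟨hR, ?_⟩
        rw [mul_comm, ← div_eq_mul_inv] at hx
        exact (ENNReal.le_div_iff_mul_le (.inl hm0) (.inl hmt)).1 hx.le
      obtain ⟨b, hb, hsub⟩ := hcov _ ha
      refine Set.mem_biUnion hb ?_
      have := hsub (ball_subset_closedBall hxb)
      convert this using 2; ring
    · rw [Set.indicator_of_notMem hxb] at hx
      simp at hx
  have hdisj' : u.PairwiseDisjoint fun a => closedBall a.1 a.2 :=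
    hdisj.mono_on fun a ha => closedBall_subset_closedBall (by have := (huS ha).1; linarith)
  calc c * μ {x | c < ballMax μ h x}
      ≤ c * ∑' a : u, μ (closedBall a.1.1 (8 * a.1.2)) := by
        gcongr
        exact (measure_mono hsub).trans (measure_biUnion_le μ hucount _)
    _ = ∑' a : u, ENNReal.ofReal (8 ^ d) * (c * μ (closedBall a.1.1 a.1.2)) := by
        rw [← ENNReal.tsum_mul_left]
        refine tsum_congr fun a => ?_
        have := (huS a.2).1
        rw [Measure.addHaar_closedBall_mul μ _ (by norm_num) this.le,
          Measure.addHaar_closedBall_center μ a.1.1]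
        ring
    _ ≤ ∑' a : u, ENNReal.ofReal (8 ^ d) * ∫⁻ y in closedBall a.1.1 a.1.2, h y ∂μ := by
        gcongr with a
        exact (huS a.2).2
    _ = ENNReal.ofReal (8 ^ d) * ∫⁻ y in ⋃ a ∈ u, closedBall a.1 a.2, h y ∂μ := by
        rw [ENNReal.tsum_mul_left, lintegral_biUnion hucount
          (fun _ _ => isClosed_closedBall.measurableSet) hdisj']
    _ ≤ _ := by
        gcongr
        exact Measure.restrict_le_self

theorem ballMax_truncated_weak [Nontrivial E] (h : E → ℝ≥0∞) (t : ℝ) :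
    ENNReal.ofReal t * μ {x | ENNReal.ofReal t < ballMax μ h x} ≤
      2 * ENNReal.ofReal (8 ^ Module.finrank ℝ E) *
        ∫⁻ x, {x | ENNReal.ofReal t < 2 * h x}.indicator h x ∂μ := by
  set k := {x | ENNReal.ofReal t < 2 * h x}.indicator h with hk
  have e2 : ENNReal.ofReal t = 2 * ENNReal.ofReal (t / 2) := by
    rw [show (2 : ℝ≥0∞) = ENNReal.ofReal 2 by simp, ← ENNReal.ofReal_mul (by norm_num)]
    congr 1; ring
  have hle : ∀ x, h x ≤ k x + ENNReal.ofReal (t / 2) := by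
    intro x
    by_cases hx : ENNReal.ofReal t < 2 * h x
    · rw [hk, Set.indicator_of_mem (by exact hx)]; exact le_self_add
    · rw [not_lt, e2] at hx
      refine le_trans ?_ le_add_self
      exact (ENNReal.mul_le_mul_iff_right (by simp) (by simp)).1 hx
  have hmax : ∀ x, ballMax μ h x ≤ ballMax μ k x + ENNReal.ofReal (t / 2) := by
    intro x
    refine iSup_le fun z => iSup_le fun R => iSup_le fun hR => ?_
    by_cases hx : x ∈ ball z (2 * R)
    · rw [Set.indicator_of_mem hx]
      have hm0 : μ (closedBall z R) ≠ 0 := (measure_closedBall_pos μ z hR).ne'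
      have hmt : μ (closedBall z R) ≠ ∞ := measure_closedBall_lt_top.ne
      calc (μ (closedBall z R))⁻¹ * ∫⁻ y in closedBall z R, h y ∂μ
          ≤ (μ (closedBall z R))⁻¹ *
            ∫⁻ y in closedBall z R, (k y + ENNReal.ofReal (t / 2)) ∂μ := by
            gcongr with y; exact hle y
        _ = (μ (closedBall z R))⁻¹ * ∫⁻ y in closedBall z R, k y ∂μ + ENNReal.ofReal (t / 2) := by
            rw [lintegral_add_right _ measurable_const, setLIntegral_const, mul_add,
              mul_left_comm, ENNReal.inv_mul_cancel hm0 hmt, mul_one]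
        _ ≤ _ := by
            gcongr
            refine le_iSup_of_le z (le_iSup_of_le R (le_iSup_of_le hR ?_))
            rw [Set.indicator_of_mem hx]
    · rw [Set.indicator_of_notMem hx]; exact zero_le
  have hsub : {x | ENNReal.ofReal t < ballMax μ h x} ⊆
      {x | ENNReal.ofReal (t / 2) < ballMax μ k x} := by
    intro x hx
    have h1 : ENNReal.ofReal t < ballMax μ k x + ENNReal.ofReal (t / 2) := lt_of_lt_of_le hx (hmax x)
    rw [e2, two_mul] at h1
    exact lt_of_add_lt_add_right h1
  calc _ ≤ 2 * ENNReal.ofReal (t / 2) * μ {x | ENNReal.ofReal (t / 2) < ballMax μ k x} := by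
        rw [← e2]; gcongr 1
        exact measure_mono hsub
    _ ≤ _ := by
        rw [mul_assoc, mul_assoc]
        gcongr 1
        exact ballMax_weak μ k _

/-- The Hardy–Littlewood maximal theorem: `L^p` boundedness for `1 < p`. -/
theorem exists_lintegral_ballMax_rpow_le [Nontrivial E] {p : ℝ} (hp : 1 < p) :
    ∃ C : ℝ≥0∞, C ≠ ∞ ∧ ∀ h : E → ℝ≥0∞, Measurable h →
      ∫⁻ x, ballMax μ h x ^ p ∂μ ≤ C * ∫⁻ x, h x ^ p ∂μ := by
  refine ⟨_, ?_, fun h hh => lintegral_rpow_le_of_truncated_weak hh (measurable_ballMax μ h) hp _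
    fun t _ => ballMax_truncated_weak μ h t⟩
  have hc : ENNReal.ofReal (p - 1) ≠ 0 := by simpa using hp
  finiteness

end Ball
section Cube

variable {n : ℕ}

theorem isClosed_cube (x : EuclideanSpace ℝ (Fin n)) (r : ℝ) : IsClosed (cube x r) := by
  simp only [cube, Set.ofPred_forall]
  exact isClosed_iInter fun i => isClosed_le (by fun_prop) continuous_const

theorem measurableSet_cube (x : EuclideanSpace ℝ (Fin n)) (r : ℝ) : MeasurableSet (cube x r) :=
  (isClosed_cube x r).measurableSet

theorem mem_cube_comm {x y : EuclideanSpace ℝ (Fin n)} {r : ℝ} :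
    y ∈ cube x r ↔ x ∈ cube y r := by
  simp only [cube, Set.mem_ofPred_eq, abs_sub_comm]

theorem cube_subset_cube {x y : EuclideanSpace ℝ (Fin n)} {a b c : ℝ} (hy : y ∈ cube x a)
    (hc : a + b ≤ c) : cube y b ⊆ cube x c := by
  intro u hu i
  have := abs_sub_le (u i) (y i) (x i)
  have := hu i
  have := hy i
  linarith

theorem mem_cube_self (x : EuclideanSpace ℝ (Fin n)) {r : ℝ} (hr : 0 ≤ r) : x ∈ cube x r := by
  intro i; simp; linarith

theorem volume_cube (x : EuclideanSpace ℝ (Fin n)) {r : ℝ} (hr : 0 ≤ r) :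
    volume (cube x r) = ENNReal.ofReal r ^ n := by
  have h : cube x r = (WithLp.ofLp : EuclideanSpace ℝ (Fin n) → Fin n → ℝ) ⁻¹'
      closedBall (WithLp.ofLp x) (r / 2) := by
    ext y
    simp [cube, dist_pi_le_iff (show 0 ≤ r / 2 by linarith), Real.dist_eq]
  rw [h, (PiLp.volume_preserving_ofLp (Fin n)).measure_preimage
    isClosed_closedBall.measurableSet.nullMeasurableSet, Real.volume_pi_closedBall _ (by linarith)]
  rw [ENNReal.ofReal_pow (by linarith), Fintype.card_fin]
  congr 2; ring

theorem volume_cube_pos (x : EuclideanSpace ℝ (Fin n)) {r : ℝ} (hr : 0 < r) :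
    volume (cube x r) ≠ 0 := by
  rw [volume_cube x hr.le]; exact pow_ne_zero _ (by simpa using hr)

theorem volume_cube_ne_top (x : EuclideanSpace ℝ (Fin n)) {r : ℝ} (hr : 0 < r) :
    volume (cube x r) ≠ ∞ := by
  rw [volume_cube x hr.le]; finiteness

theorem volume_cube_mul (x y : EuclideanSpace ℝ (Fin n)) {c r : ℝ} (hc : 0 ≤ c) (hr : 0 ≤ r) :
    volume (cube x (c * r)) = ENNReal.ofReal c ^ n * volume (cube y r) := by
  rw [volume_cube x (by positivity), volume_cube y hr, ENNReal.ofReal_mul hc, mul_pow]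

theorem cube_subset_closedBall (x : EuclideanSpace ℝ (Fin n)) {r : ℝ} :
    cube x r ⊆ closedBall x (n * (r / 2)) := by
  intro y hy
  rw [mem_closedBall, EuclideanSpace.dist_eq]
  calc √(∑ i, dist (y i) (x i) ^ 2) ≤ ∑ i, dist (y i) (x i) := by
        refine Real.sqrt_le_iff.2 ⟨Finset.sum_nonneg fun _ _ => dist_nonneg, ?_⟩
        exact Finset.sum_sq_le_sq_sum_of_nonneg fun _ _ => dist_nonneg
    _ ≤ ∑ _i : Fin n, r / 2 := Finset.sum_le_sum fun i _ => by
        rw [Real.dist_eq]; exact hy i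
    _ = n * (r / 2) := by simp

theorem closedBall_subset_cube (x : EuclideanSpace ℝ (Fin n)) (r : ℝ) :
    closedBall x (r / 2) ⊆ cube x r := by
  intro y hy i
  rw [mem_closedBall, dist_eq_norm] at hy
  exact (PiLp.norm_apply_le (y - x) i).trans hy

/-- Averages increase under passing to `L^p` averages. -/
theorem inv_mul_setLIntegral_le_rpow {X : Type*} [MeasurableSpace X] {μ : Measure X} {S : Set X}
    (h0 : μ S ≠ 0) (ht : μ S ≠ ∞) {p : ℝ} (hp : 1 < p) {h : X → ℝ≥0∞} (hh : Measurable h) :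
    (μ S)⁻¹ * ∫⁻ y in S, h y ∂μ ≤ ((μ S)⁻¹ * ∫⁻ y in S, h y ^ p ∂μ) ^ (1 / p) := by
  have hpq := Real.HolderConjugate.conjExponent hp
  have h1 := ENNReal.lintegral_mul_le_Lp_mul_Lq (μ.restrict S) hpq hh.aemeasurable
    (aemeasurable_const (b := (1 : ℝ≥0∞)))
  simp only [Pi.mul_apply, mul_one, ENNReal.one_rpow, lintegral_const, one_mul,
    Measure.restrict_apply_univ] at h1
  calc (μ S)⁻¹ * ∫⁻ y in S, h y ∂μ
      ≤ (μ S)⁻¹ * ((∫⁻ y in S, h y ^ p ∂μ) ^ (1 / p) * μ S ^ (1 / p.conjExponent)) := by gcongr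
    _ = (μ S) ^ (-(1 / p)) * (∫⁻ y in S, h y ^ p ∂μ) ^ (1 / p) := by
        have : -(1 / p) = -1 + 1 / p.conjExponent := by
          have := hpq.inv_add_inv_eq_one
          simp only [one_div]; linarith
        rw [this, ENNReal.rpow_add _ _ h0 ht, ENNReal.rpow_neg_one]
        ring
    _ = _ := by
        rw [ENNReal.mul_rpow_of_nonneg _ _ (by positivity), ENNReal.rpow_neg, ENNReal.inv_rpow]

/-- The fractional maximal function over cubes of an extended nonnegative function, normalized by
the exponent of the volume. -/
def cubeMax (β : ℝ) (h : EuclideanSpace ℝ (Fin n) → ℝ≥0∞) (x : EuclideanSpace ℝ (Fin n)) : ℝ≥0∞ :=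
  ⨆ (z : EuclideanSpace ℝ (Fin n)) (r : ℝ) (_ : 0 < r) (_ : x ∈ cube z r),
    volume (cube z r) ^ (β - 1) * ∫⁻ y in cube z r, h y

theorem le_cubeMax (β : ℝ) (h : EuclideanSpace ℝ (Fin n) → ℝ≥0∞) {x z : EuclideanSpace ℝ (Fin n)}
    {r : ℝ} (hr : 0 < r) (hx : x ∈ cube z r) :
    volume (cube z r) ^ (β - 1) * ∫⁻ y in cube z r, h y ≤ cubeMax β h x :=
  le_iSup_of_le z <| le_iSup_of_le r <| le_iSup_of_le hr <| le_iSup_of_le hx le_rfl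

theorem setLIntegral_le_rpow_mul_cubeMax (β : ℝ) (h : EuclideanSpace ℝ (Fin n) → ℝ≥0∞)
    {x z : EuclideanSpace ℝ (Fin n)} {r : ℝ} (hr : 0 < r) (hx : x ∈ cube z r) :
    ∫⁻ y in cube z r, h y ≤ volume (cube z r) ^ (1 - β) * cubeMax β h x := by
  have h0 := volume_cube_pos z hr
  have ht := volume_cube_ne_top z hr
  calc ∫⁻ y in cube z r, h y = volume (cube z r) ^ (1 - β) *
        (volume (cube z r) ^ (β - 1) * ∫⁻ y in cube z r, h y) := by
        rw [← mul_assoc, ← ENNReal.rpow_add _ _ h0 ht]; simp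
    _ ≤ _ := by gcongr; exact le_cubeMax β h hr hx

theorem cubeMax_zero_le_ballMax (hn : 1 ≤ n) (h : EuclideanSpace ℝ (Fin n) → ℝ≥0∞)
    (x : EuclideanSpace ℝ (Fin n)) :
    cubeMax 0 h x ≤ ENNReal.ofReal (n ^ n) * ballMax volume h x := by
  refine iSup_le fun z => iSup_le fun r => iSup_le fun hr => iSup_le fun hx => ?_
  have hn' : (0 : ℝ) < n := by exact_mod_cast hn
  have hR : 0 < n * (r / 2) := by positivity
  have hvol : volume (closedBall z (n * (r / 2))) ≤ ENNReal.ofReal (n ^ n) * volume (cube z r) := by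
    rw [Measure.addHaar_closedBall_mul volume z hn'.le (by positivity),
      ← Measure.addHaar_closedBall_center volume z, finrank_euclideanSpace_fin]
    gcongr
    exact closedBall_subset_cube z r
  have hm0 : volume (closedBall z (n * (r / 2))) ≠ 0 := (measure_closedBall_pos _ z hR).ne'
  have hmt : volume (closedBall z (n * (r / 2))) ≠ ∞ := measure_closedBall_lt_top.ne
  have hinv : (volume (cube z r))⁻¹ ≤
      ENNReal.ofReal (n ^ n) * (volume (closedBall z (n * (r / 2))))⁻¹ := by
    rw [← div_eq_mul_inv, ENNReal.le_div_iff_mul_le (.inl hm0) (.inl hmt)]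
    calc _ ≤ (volume (cube z r))⁻¹ * (ENNReal.ofReal (n ^ n) * volume (cube z r)) := by gcongr
      _ = _ := by
        rw [mul_left_comm, ENNReal.inv_mul_cancel (volume_cube_pos z hr) (volume_cube_ne_top z hr),
          mul_one]
  calc volume (cube z r) ^ ((0 : ℝ) - 1) * ∫⁻ y in cube z r, h y
      ≤ ENNReal.ofReal (n ^ n) * (volume (closedBall z (n * (r / 2))))⁻¹ *
        ∫⁻ y in closedBall z (n * (r / 2)), h y := by
        rw [zero_sub, ENNReal.rpow_neg_one]
        gcongr
        exact cube_subset_closedBall z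
    _ ≤ _ := by
        rw [mul_assoc]
        gcongr
        refine le_iSup_of_le z <| le_iSup_of_le (n * (r / 2)) <| le_iSup_of_le hR ?_
        rw [Set.indicator_of_mem]
        exact closedBall_subset_ball (by linarith) (cube_subset_closedBall z hx)

/-- Hedberg's inequality. -/
theorem cubeMax_le_hedberg {p r β : ℝ} (hp : 1 < p) (hpr : p < r) (hβ : β = 1 / p - 1 / r)
    {h : EuclideanSpace ℝ (Fin n) → ℝ≥0∞} (hh : Measurable h) (x : EuclideanSpace ℝ (Fin n)) :
    cubeMax β h x ≤
      cubeMax 0 h x ^ (p / r) * ((∫⁻ y, h y ^ p) ^ (1 / p)) ^ (1 - p / r) := by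
  refine iSup_le fun z => iSup_le fun ρ => iSup_le fun hρ => iSup_le fun hx => ?_
  have hp0 : 0 < p := by linarith
  have hr0 : 0 < r := by linarith
  have hθ0 : 0 ≤ p / r := by positivity
  have hθ1 : 0 ≤ 1 - p / r := by rw [sub_nonneg, div_le_one hr0]; exact hpr.le
  have h0 := volume_cube_pos z hρ
  have ht := volume_cube_ne_top z hρ
  set V := volume (cube z ρ) with hV
  set A := V⁻¹ * ∫⁻ y in cube z ρ, h y with hA
  have hA1 : A ≤ cubeMax 0 h x := by
    have := le_cubeMax 0 h hρ hx
    rwa [zero_sub, ENNReal.rpow_neg_one] at this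
  have hA2 : A ≤ V ^ (-(1 / p)) * (∫⁻ y, h y ^ p) ^ (1 / p) := by
    refine (inv_mul_setLIntegral_le_rpow h0 ht hp hh).trans ?_
    rw [ENNReal.mul_rpow_of_nonneg _ _ (by positivity), ENNReal.rpow_neg, ENNReal.inv_rpow]
    gcongr
    exact Measure.restrict_le_self
  calc V ^ (β - 1) * ∫⁻ y in cube z ρ, h y
      = V ^ β * A := by
        rw [hA, ← mul_assoc, ← ENNReal.rpow_neg_one, ← ENNReal.rpow_add _ _ h0 ht, sub_eq_add_neg]
    _ = V ^ β * (A ^ (p / r) * A ^ (1 - p / r)) := by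
        rw [← ENNReal.rpow_add_of_nonneg _ _ hθ0 hθ1]; simp
    _ ≤ V ^ β * (cubeMax 0 h x ^ (p / r) *
        (V ^ (-(1 / p)) * (∫⁻ y, h y ^ p) ^ (1 / p)) ^ (1 - p / r)) := by gcongr
    _ = (V ^ β * V ^ (-β)) * (cubeMax 0 h x ^ (p / r) *
        ((∫⁻ y, h y ^ p) ^ (1 / p)) ^ (1 - p / r)) := by
        have : V ^ (-β) = (V ^ (-(1 / p))) ^ (1 - p / r) := by
          rw [← ENNReal.rpow_mul]; congr 1; rw [hβ]; field_simp
        rw [ENNReal.mul_rpow_of_nonneg _ _ hθ1, this]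
        ring
    _ = _ := by rw [← ENNReal.rpow_add _ _ h0 ht]; simp

/-- The fractional maximal operator maps `L^p` to `L^r`. -/
theorem exists_lintegral_cubeMax_rpow_le (hn : 1 ≤ n) {p r β : ℝ} (hp : 1 < p) (hpr : p < r)
    (hβ : β = 1 / p - 1 / r) :
    ∃ C : ℝ≥0∞, C ≠ ∞ ∧ ∀ h : EuclideanSpace ℝ (Fin n) → ℝ≥0∞, Measurable h →
      ∫⁻ x, cubeMax β h x ^ r ≤ C * (∫⁻ x, h x ^ p) ^ (r / p) := by
  have hp0 : 0 < p := by linarith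
  have hr0 : 0 < r := by linarith
  have : Nonempty (Fin n) := ⟨⟨0, hn⟩⟩
  obtain ⟨C, hC, hmax⟩ := exists_lintegral_ballMax_rpow_le
    (volume : Measure (EuclideanSpace ℝ (Fin n))) hp
  refine ⟨ENNReal.ofReal (n ^ n) ^ p * C, by finiteness, fun h hh => ?_⟩
  have hm := measurable_ballMax volume h
  set I := ∫⁻ x, h x ^ p with hI
  calc ∫⁻ x, cubeMax β h x ^ r
      ≤ ∫⁻ x, I ^ (r / p - 1) * ENNReal.ofReal (n ^ n) ^ p * ballMax volume h x ^ p := by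
        refine lintegral_mono fun x => ?_
        calc cubeMax β h x ^ r
            ≤ ((ENNReal.ofReal (n ^ n) * ballMax volume h x) ^ (p / r) *
              (I ^ (1 / p)) ^ (1 - p / r)) ^ r := by
              have h1 := cubeMax_le_hedberg hp hpr hβ hh x
              have h2 := cubeMax_zero_le_ballMax hn h x
              refine ENNReal.rpow_le_rpow (h1.trans ?_) hr0.le
              gcongr
          _ = _ := by
              rw [ENNReal.mul_rpow_of_nonneg _ _ hr0.le, ← ENNReal.rpow_mul, ← ENNReal.rpow_mul,
                ← ENNReal.rpow_mul, div_mul_cancel₀ _ hr0.ne',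
                ENNReal.mul_rpow_of_nonneg _ _ hp0.le]
              have : 1 / p * ((1 - p / r) * r) = r / p - 1 := by field_simp
              rw [this]
              ring
    _ = I ^ (r / p - 1) * ENNReal.ofReal (n ^ n) ^ p * ∫⁻ x, ballMax volume h x ^ p :=
        lintegral_const_mul _ (by fun_prop)
    _ ≤ I ^ (r / p - 1) * ENNReal.ofReal (n ^ n) ^ p * (C * I) := by
        gcongr; exact hmax h hh
    _ = ENNReal.ofReal (n ^ n) ^ p * C * (I ^ (r / p - 1) * I ^ (1 : ℝ)) := by
        rw [ENNReal.rpow_one]; ring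
    _ = _ := by
        rw [← ENNReal.rpow_add_of_nonneg _ _ _ zero_le_one]
        · simp
        · rw [sub_nonneg, one_le_div hp0]; exact hpr.le

theorem measurableSet_setOf_mem_cube (r : ℝ) :
    MeasurableSet {z : EuclideanSpace ℝ (Fin n) × EuclideanSpace ℝ (Fin n) |
      z.2 ∈ cube z.1 r} := by
  have : {z : EuclideanSpace ℝ (Fin n) × EuclideanSpace ℝ (Fin n) | z.2 ∈ cube z.1 r} =
      ⋂ i, {z | |z.2 i - z.1 i| ≤ r / 2} := by
    ext z; simp [cube]
  rw [this]
  exact (isClosed_iInter fun i => isClosed_le (by fun_prop) continuous_const).measurableSet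

theorem measurable_setLIntegral_cube {F : EuclideanSpace ℝ (Fin n) → ℝ≥0∞} (hF : Measurable F)
    (τ : ℝ) : Measurable fun w => ∫⁻ y in cube w τ, F y := by
  have := ((hF.comp measurable_snd).indicator (measurableSet_setOf_mem_cube τ)).lintegral_prod_right' (ν := volume)
  convert this using 2 with w
  rw [← lintegral_indicator (measurableSet_cube w τ)]
  rfl

/-- Averaging over translated cubes. -/
theorem volume_cube_mul_setLIntegral_le {F : EuclideanSpace ℝ (Fin n) → ℝ≥0∞} (hF : Measurable F)
    {τ : ℝ} (hτ : 0 ≤ τ) {S T : Set (EuclideanSpace ℝ (Fin n))} (hS : MeasurableSet S)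
    (hST : ∀ v ∈ S, cube v τ ⊆ T) :
    ENNReal.ofReal τ ^ n * ∫⁻ v in S, F v ≤ ∫⁻ w in T, ∫⁻ y in cube w τ, F y := by
  have hmeas : Measurable (Function.uncurry fun w v => (cube w τ).indicator F v) :=
    (hF.comp measurable_snd).indicator (measurableSet_setOf_mem_cube τ)
  calc ENNReal.ofReal τ ^ n * ∫⁻ v in S, F v
      = ∫⁻ v in S, ENNReal.ofReal τ ^ n * F v := (lintegral_const_mul _ hF).symm
    _ ≤ ∫⁻ v in S, ∫⁻ w in T, (cube w τ).indicator F v := by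
        refine setLIntegral_mono' hS fun v hv => ?_
        have : ∀ w, (cube w τ).indicator F v = (cube v τ).indicator (fun _ => F v) w := by
          intro w
          by_cases hw : v ∈ cube w τ
          · rw [Set.indicator_of_mem hw, Set.indicator_of_mem (mem_cube_comm.1 hw)]
          · rw [Set.indicator_of_notMem hw, Set.indicator_of_notMem fun h => hw (mem_cube_comm.1 h)]
        simp only [this]
        rw [lintegral_indicator (measurableSet_cube v τ), setLIntegral_const,
          Measure.restrict_apply (measurableSet_cube v τ), Set.inter_eq_left.2 (hST v hv),
          volume_cube v hτ, mul_comm]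
    _ ≤ ∫⁻ v, ∫⁻ w in T, (cube w τ).indicator F v := setLIntegral_le_lintegral _ _
    _ = ∫⁻ w in T, ∫⁻ v, (cube w τ).indicator F v :=
        (lintegral_lintegral_swap hmeas.aemeasurable).symm
    _ = _ := lintegral_congr fun w => lintegral_indicator (measurableSet_cube w τ) _

/-- The `L^p` average over the cube of side length `t` centered at `w`. -/
def cubeAvg (p t : ℝ) (h : EuclideanSpace ℝ (Fin n) → ℝ≥0∞) (w : EuclideanSpace ℝ (Fin n)) :
    ℝ≥0∞ :=
  ((volume (cube w t))⁻¹ * ∫⁻ y in cube w t, h y ^ p) ^ (1 / p)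

theorem measurable_cubeAvg {p t : ℝ} (ht : 0 ≤ t) {h : EuclideanSpace ℝ (Fin n) → ℝ≥0∞}
    (hh : Measurable h) : Measurable (cubeAvg p t h) := by
  unfold cubeAvg
  simp only [volume_cube _ ht]
  exact ((measurable_setLIntegral_cube (hh.pow_const p) t).const_mul _).pow_const _

theorem ofReal_pow_mul_rpow_le {c β : ℝ} (hc : 1 ≤ c) (hβ0 : 0 ≤ β) (hβ1 : β ≤ 1) (V : ℝ≥0∞) :
    (ENNReal.ofReal c ^ n * V) ^ (1 - β) ≤ ENNReal.ofReal c ^ n * V ^ (1 - β) := by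
  rw [ENNReal.mul_rpow_of_nonneg _ _ (by linarith)]
  gcongr
  calc (ENNReal.ofReal c ^ n) ^ (1 - β) ≤ (ENNReal.ofReal c ^ n) ^ (1 : ℝ) :=
        ENNReal.rpow_le_rpow_of_exponent_le (one_le_pow₀ (by simpa using hc)) (by linarith)
    _ = _ := ENNReal.rpow_one _

/-- The contribution of cubes larger than the slice scale. -/
theorem large_cube_le_cubeMax_cubeAvg {p t β : ℝ} (hp : 1 < p) (ht : 0 < t) (hβ0 : 0 ≤ β)
    (hβ1 : β ≤ 1) {h : EuclideanSpace ℝ (Fin n) → ℝ≥0∞} (hh : Measurable h)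
    {x y z : EuclideanSpace ℝ (Fin n)} {ρ : ℝ} (hρ : t ≤ ρ) (hyz : y ∈ cube z ρ)
    (hyx : y ∈ cube x t) :
    volume (cube z ρ) ^ (β - 1) * ∫⁻ u in cube z ρ, h u ≤
      ENNReal.ofReal 2 ^ n * cubeMax β (cubeAvg p t h) x := by
  have hρ0 : 0 < ρ := ht.trans_le hρ
  have h0 := volume_cube_pos z hρ0
  have htop := volume_cube_ne_top z hρ0
  have hx : x ∈ cube z (2 * ρ) :=
    cube_subset_cube hyz (by linarith) (mem_cube_comm.1 hyx)
  have h1 : ∫⁻ u in cube z ρ, h u ≤ ∫⁻ w in cube z (2 * ρ), cubeAvg p t h w := by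
    have h2 := volume_cube_mul_setLIntegral_le hh ht.le (T := cube z (2 * ρ))
      (measurableSet_cube z ρ) fun v hv => cube_subset_cube hv (by linarith)
    rw [← volume_cube x ht.le] at h2
    have hx0 := volume_cube_pos x ht
    have hxt := volume_cube_ne_top x ht
    calc ∫⁻ u in cube z ρ, h u
        = (volume (cube x t))⁻¹ * (volume (cube x t) * ∫⁻ u in cube z ρ, h u) := by
          rw [← mul_assoc, ENNReal.inv_mul_cancel hx0 hxt, one_mul]
      _ ≤ (volume (cube x t))⁻¹ * ∫⁻ w in cube z (2 * ρ), ∫⁻ y in cube w t, h y := by gcongr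
      _ = ∫⁻ w in cube z (2 * ρ), (volume (cube x t))⁻¹ * ∫⁻ y in cube w t, h y :=
          (lintegral_const_mul _ (measurable_setLIntegral_cube hh t)).symm
      _ ≤ _ := by
          refine lintegral_mono fun w => ?_
          rw [volume_cube x ht.le, ← volume_cube w ht.le]
          exact inv_mul_setLIntegral_le_rpow (volume_cube_pos w ht) (volume_cube_ne_top w ht) hp hh
  calc volume (cube z ρ) ^ (β - 1) * ∫⁻ u in cube z ρ, h u
      ≤ volume (cube z ρ) ^ (β - 1) * (volume (cube z (2 * ρ)) ^ (1 - β) *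
          cubeMax β (cubeAvg p t h) x) := by
        gcongr
        exact h1.trans (setLIntegral_le_rpow_mul_cubeMax β _ (by positivity) hx)
    _ ≤ volume (cube z ρ) ^ (β - 1) * ((ENNReal.ofReal 2 ^ n * volume (cube z ρ) ^ (1 - β)) *
          cubeMax β (cubeAvg p t h) x) := by
        gcongr
        rw [volume_cube_mul z z (by norm_num) hρ0.le]
        exact ofReal_pow_mul_rpow_le (by norm_num) hβ0 hβ1 _
    _ = (volume (cube z ρ) ^ (β - 1) * volume (cube z ρ) ^ (1 - β)) * (ENNReal.ofReal 2 ^ n *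
          cubeMax β (cubeAvg p t h) x) := by ring
    _ = _ := by rw [← ENNReal.rpow_add _ _ h0 htop]; simp

/-- At the slice scale, `L^p` norms on a cube are controlled by the fractional maximal function of
the `L^p` averages. -/
theorem setLIntegral_rpow_le_cubeMax_cubeAvg {p t β : ℝ} (hp : 1 < p) (ht : 0 < t) (hβ0 : 0 ≤ β)
    (hβ1 : β ≤ 1) {h : EuclideanSpace ℝ (Fin n) → ℝ≥0∞} (hh : Measurable h)
    (x : EuclideanSpace ℝ (Fin n)) :
    ∫⁻ y in cube x (3 * t), h y ^ p ≤ ENNReal.ofReal 8 ^ n * volume (cube x t) *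
      (ENNReal.ofReal 10 ^ n * volume (cube x t) ^ (-β) * cubeMax β (cubeAvg p t h) x) ^ p := by
  have hp0 : 0 < p := by linarith
  set V := volume (cube x t) with hV
  have h0 : V ≠ 0 := volume_cube_pos x ht
  have htop : V ≠ ∞ := volume_cube_ne_top x ht
  set M := cubeMax β (cubeAvg p t h) x with hM
  set W := volume (cube x (t / 2)) with hW
  have hW0 : W ≠ 0 := volume_cube_pos x (by positivity)
  have hWt : W ≠ ∞ := volume_cube_ne_top x (by positivity)
  have hVW : V = ENNReal.ofReal 2 ^ n * W := by
    rw [hV, hW, ← volume_cube_mul x x (by norm_num) (by positivity)]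
    congr 2; ring
  have hlocal : ∀ v ∈ cube x (4 * t), ∫⁻ y in cube v (t / 2), h y ^ p ≤
      V * (ENNReal.ofReal 10 ^ n * V ^ (-β) * M) ^ p := by
    intro v hv
    set Φ := ∫⁻ y in cube v (t / 2), h y ^ p with hΦ
    have hVv : volume (cube v (t / 2)) = W := by
      rw [hW, volume_cube v (by positivity), volume_cube x (by positivity)]
    have h1 : ∀ w ∈ cube v (t / 2), (V⁻¹ * Φ) ^ (1 / p) ≤ cubeAvg p t h w := by
      intro w hw
      have hVw : volume (cube w t) = V := by
        rw [hV, volume_cube w ht.le, volume_cube x ht.le]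
      rw [cubeAvg, hVw]
      gcongr (V⁻¹ * ?_) ^ (1 / p)
      exact lintegral_mono_set (cube_subset_cube (mem_cube_comm.1 hw) (by linarith))
    have h2 : (V⁻¹ * Φ) ^ (1 / p) * W ≤ ENNReal.ofReal 5 ^ n * V ^ (1 - β) * M := by
      calc (V⁻¹ * Φ) ^ (1 / p) * W = ∫⁻ _ in cube v (t / 2), (V⁻¹ * Φ) ^ (1 / p) := by
            rw [setLIntegral_const, hVv]
        _ ≤ ∫⁻ w in cube v (t / 2), cubeAvg p t h w :=
            setLIntegral_mono' (measurableSet_cube _ _) h1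
        _ ≤ ∫⁻ w in cube x (5 * t), cubeAvg p t h w :=
            lintegral_mono_set (cube_subset_cube hv (by linarith))
        _ ≤ volume (cube x (5 * t)) ^ (1 - β) * M :=
            setLIntegral_le_rpow_mul_cubeMax β _ (by positivity) (mem_cube_self x (by positivity))
        _ ≤ _ := by
            rw [volume_cube_mul x x (by norm_num) ht.le]
            gcongr
            exact ofReal_pow_mul_rpow_le (by norm_num) hβ0 hβ1 _
    have h3 : (V⁻¹ * Φ) ^ (1 / p) ≤ ENNReal.ofReal 10 ^ n * V ^ (-β) * M := by
      calc (V⁻¹ * Φ) ^ (1 / p) = V⁻¹ * (ENNReal.ofReal 2 ^ n * ((V⁻¹ * Φ) ^ (1 / p) * W)) := by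
            rw [mul_left_comm (ENNReal.ofReal 2 ^ n), ← hVW, mul_left_comm,
              ENNReal.inv_mul_cancel h0 htop, mul_one]
        _ ≤ V⁻¹ * (ENNReal.ofReal 2 ^ n * (ENNReal.ofReal 5 ^ n * V ^ (1 - β) * M)) := by gcongr
        _ = _ := by
            have e1 : ENNReal.ofReal 10 ^ n = ENNReal.ofReal 2 ^ n * ENNReal.ofReal 5 ^ n := by
              rw [← mul_pow, ← ENNReal.ofReal_mul (by norm_num)]; norm_num
            have e2 : V ^ (-β) = V⁻¹ * V ^ (1 - β) := by
              rw [← ENNReal.rpow_neg_one, ← ENNReal.rpow_add _ _ h0 htop]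
              congr 1; ring
            rw [e1, e2]
            ring
    calc Φ = V * ((V⁻¹ * Φ) ^ (1 / p)) ^ p := by
          rw [← ENNReal.rpow_mul, one_div_mul_cancel hp0.ne', ENNReal.rpow_one, ← mul_assoc,
            ENNReal.mul_inv_cancel h0 htop, one_mul]
      _ ≤ _ := by gcongr
  have hswap := volume_cube_mul_setLIntegral_le (hh.pow_const p) (τ := t / 2) (by positivity)
    (T := cube x (4 * t)) (measurableSet_cube x (3 * t))
    fun v hv => cube_subset_cube hv (by linarith)
  rw [← volume_cube x (by positivity), ← hW] at hswap
  have hW4 : volume (cube x (4 * t)) = ENNReal.ofReal 8 ^ n * W := by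
    rw [← volume_cube_mul x x (by norm_num) (by positivity)]
    congr 2; ring
  calc ∫⁻ y in cube x (3 * t), h y ^ p
      = W⁻¹ * (W * ∫⁻ y in cube x (3 * t), h y ^ p) := by
        rw [← mul_assoc, ENNReal.inv_mul_cancel hW0 hWt, one_mul]
    _ ≤ W⁻¹ * ∫⁻ w in cube x (4 * t), ∫⁻ y in cube w (t / 2), h y ^ p := by gcongr
    _ ≤ W⁻¹ * ∫⁻ _ in cube x (4 * t), V * (ENNReal.ofReal 10 ^ n * V ^ (-β) * M) ^ p := by
        gcongr 1
        exact setLIntegral_mono' (measurableSet_cube _ _) hlocal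
    _ = (W⁻¹ * W) * (ENNReal.ofReal 8 ^ n * V * (ENNReal.ofReal 10 ^ n * V ^ (-β) * M) ^ p) := by
        rw [setLIntegral_const, hW4]; ring
    _ = _ := by rw [ENNReal.inv_mul_cancel hW0 hWt, one_mul]

theorem cubeMax_le_local_add_global {p t β : ℝ} (hp : 1 < p) (ht : 0 < t) (hβ0 : 0 ≤ β)
    (hβ1 : β ≤ 1) {h : EuclideanSpace ℝ (Fin n) → ℝ≥0∞} (hh : Measurable h)
    {x y : EuclideanSpace ℝ (Fin n)} (hyx : y ∈ cube x t) :
    cubeMax β h y ≤ cubeMax β ((cube x (3 * t)).indicator h) y +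
      ENNReal.ofReal 2 ^ n * cubeMax β (cubeAvg p t h) x := by
  refine iSup_le fun z => iSup_le fun ρ => iSup_le fun hρ => iSup_le fun hyz => ?_
  rcases le_total t ρ with htρ | htρ
  · exact (large_cube_le_cubeMax_cubeAvg hp ht hβ0 hβ1 hh htρ hyz hyx).trans le_add_self
  · refine le_trans ?_ le_self_add
    have hsub : cube z ρ ⊆ cube x (3 * t) :=
      (cube_subset_cube (mem_cube_comm.1 hyz) (c := 2 * ρ) (by linarith)).trans
        (cube_subset_cube hyx (by linarith))
    have : ∫⁻ u in cube z ρ, h u = ∫⁻ u in cube z ρ, (cube x (3 * t)).indicator h u :=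
      setLIntegral_congr_fun (measurableSet_cube _ _) fun u hu =>
        (Set.indicator_of_mem (hsub hu) h).symm
    rw [this]
    exact le_cubeMax β _ hρ hyz

theorem exists_cubeAvg_cubeMax_le (hn : 1 ≤ n) {p r β : ℝ} (hp : 1 < p) (hpr : p < r)
    (hβ : β = 1 / p - 1 / r) (hβ0 : 0 ≤ β) (hβ1 : β ≤ 1) :
    ∃ C : ℝ≥0∞, C ≠ ∞ ∧ ∀ t : ℝ, 0 < t → ∀ h : EuclideanSpace ℝ (Fin n) → ℝ≥0∞, Measurable h →
      ∀ x, cubeAvg r t (cubeMax β h) x ≤ C * cubeMax β (cubeAvg p t h) x := by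
  have hp0 : 0 < p := by linarith
  have hr0 : 0 < r := by linarith
  obtain ⟨A, hA, hmax⟩ := exists_lintegral_cubeMax_rpow_le hn hp hpr hβ
  set c : ℝ≥0∞ := A * (ENNReal.ofReal 8 ^ n) ^ (r / p) * (ENNReal.ofReal 10 ^ n) ^ r with hc
  set d : ℝ≥0∞ := (ENNReal.ofReal 2 ^ n) ^ r with hd
  have hrp : 0 ≤ r / p := by positivity
  have hct : c ≠ ∞ := by finiteness
  have hdt : d ≠ ∞ := by finiteness
  refine ⟨(2 ^ (r - 1) * (c + d)) ^ (1 / r), by finiteness, fun t ht h hh x => ?_⟩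
  set V := volume (cube x t) with hV
  have h0 : V ≠ 0 := volume_cube_pos x ht
  have htop : V ≠ ∞ := volume_cube_ne_top x ht
  set M := cubeMax β (cubeAvg p t h) x with hM
  set L := cubeMax β ((cube x (3 * t)).indicator h) with hL
  have hlocal : ∫⁻ y, L y ^ r ≤ V * (c * M ^ r) := by
    have h1 : ∫⁻ y, (cube x (3 * t)).indicator h y ^ p = ∫⁻ y in cube x (3 * t), h y ^ p := by
      rw [← lintegral_indicator (measurableSet_cube _ _)]
      refine lintegral_congr fun y => ?_
      by_cases hy : y ∈ cube x (3 * t) <;> simp [hy, hp0]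
    calc ∫⁻ y, L y ^ r ≤ A * (∫⁻ y in cube x (3 * t), h y ^ p) ^ (r / p) := by
          rw [← h1]; exact hmax _ (hh.indicator (measurableSet_cube _ _))
      _ ≤ A * (ENNReal.ofReal 8 ^ n * V *
          (ENNReal.ofReal 10 ^ n * V ^ (-β) * M) ^ p) ^ (r / p) := by
          gcongr
          exact setLIntegral_rpow_le_cubeMax_cubeAvg hp ht hβ0 hβ1 hh x
      _ = (V ^ (r / p) * V ^ (-β * r)) * (c * M ^ r) := by
          rw [ENNReal.mul_rpow_of_nonneg _ _ hrp, ENNReal.mul_rpow_of_nonneg _ _ hrp,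
            ← ENNReal.rpow_mul, mul_div_cancel₀ _ hp0.ne', ENNReal.mul_rpow_of_nonneg _ _ hr0.le,
            ENNReal.mul_rpow_of_nonneg _ _ hr0.le, ← ENNReal.rpow_mul V, hc]
          ring
      _ = _ := by
          rw [← ENNReal.rpow_add _ _ h0 htop]
          have : r / p + -β * r = 1 := by rw [hβ]; field_simp; ring
          rw [this, ENNReal.rpow_one]
  have key : V⁻¹ * ∫⁻ y in cube x t, cubeMax β h y ^ r ≤ 2 ^ (r - 1) * (c + d) * M ^ r := by
    calc V⁻¹ * ∫⁻ y in cube x t, cubeMax β h y ^ r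
        ≤ V⁻¹ * ∫⁻ y in cube x t, 2 ^ (r - 1) * (L y ^ r + d * M ^ r) := by
          gcongr 1
          refine setLIntegral_mono' (measurableSet_cube _ _) fun y hy => ?_
          rw [hd, ← ENNReal.mul_rpow_of_nonneg _ _ hr0.le]
          refine le_trans ?_ (ENNReal.rpow_add_le_mul_rpow_add_rpow _ _ (by linarith))
          gcongr
          exact cubeMax_le_local_add_global hp ht hβ0 hβ1 hh hy
      _ = V⁻¹ * (2 ^ (r - 1) * ((∫⁻ y in cube x t, L y ^ r) + d * M ^ r * V)) := by
          rw [lintegral_const_mul' _ _ (by finiteness), lintegral_add_right _ measurable_const,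
            setLIntegral_const]
      _ ≤ V⁻¹ * (2 ^ (r - 1) * (V * (c * M ^ r) + d * M ^ r * V)) := by
          gcongr
          exact (setLIntegral_le_lintegral _ _).trans hlocal
      _ = (V⁻¹ * V) * (2 ^ (r - 1) * (c + d) * M ^ r) := by ring
      _ = _ := by rw [ENNReal.inv_mul_cancel h0 htop, one_mul]
  calc cubeAvg r t (cubeMax β h) x ≤ (2 ^ (r - 1) * (c + d) * M ^ r) ^ (1 / r) := by
        unfold cubeAvg; gcongr
    _ = _ := by
        rw [ENNReal.mul_rpow_of_nonneg _ _ (by positivity), ← ENNReal.rpow_mul,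
          mul_one_div_cancel hr0.ne', ENNReal.rpow_one]

theorem sliceNormE_eq_lintegral_cubeAvg (p q t : ℝ) (h : EuclideanSpace ℝ (Fin n) → ℝ≥0∞) :
    sliceNormE p q t h = (∫⁻ x, cubeAvg p t h x ^ q) ^ (1 / q) := by
  simp only [sliceNormE, cubeAvg, ← ENNReal.rpow_mul]
  congr! 4
  ring

end Cube

theorem statement7 (n : ℕ) (hn : 1 ≤ n) (α : ℝ) (hα0 : 0 ≤ α) (hαn : α < n)
    (p q r s : ℝ) (hp1 : 1 < p) (hpr : p < r) (hq1 : 1 < q) (hqs : q < s)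
    (hpr' : α / n = 1 / p - 1 / r) (hqs' : α / n = 1 / q - 1 / s) :
    ∃ C > (0 : ℝ), ∀ t : ℝ, 0 < t → ∀ f : EuclideanSpace ℝ (Fin n) → ℝ, MemSlice p q t f →
      sliceNormE r s t (fracMax α f) ≤ ENNReal.ofReal C * sliceNorm p q t f := by
  have hn0 : (0 : ℝ) < n := by exact_mod_cast hn
  have hq0 : 0 < q := by linarith
  have hs0 : 0 < s := by linarith
  have hβ0 : 0 ≤ α / n := by positivity
  have hβ1 : α / n ≤ 1 := by rw [div_le_one hn0]; exact hαn.le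
  obtain ⟨A, hA, hpoint⟩ := exists_cubeAvg_cubeMax_le hn hp1 hpr hpr' hβ0 hβ1
  obtain ⟨B, hB, hmax⟩ := exists_lintegral_cubeMax_rpow_le hn hq1 hqs hqs'
  have hs1 : 0 ≤ 1 / s := by positivity
  set K : ℝ≥0∞ := A * B ^ (1 / s) with hK
  have hKt : K ≠ ∞ := by finiteness
  refine ⟨K.toReal + 1, by positivity, fun t ht f hf => ?_⟩
  have hh : Measurable fun y => ENNReal.ofReal |f y| := by
    have := hf.1
    fun_prop
  set h : EuclideanSpace ℝ (Fin n) → ℝ≥0∞ := fun y => ENNReal.ofReal |f y| with h_def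
  have hfrac : fracMax α f = cubeMax (α / n) h := rfl
  calc sliceNormE r s t (fracMax α f)
      = (∫⁻ x, cubeAvg r t (cubeMax (α / n) h) x ^ s) ^ (1 / s) := by
        rw [hfrac, sliceNormE_eq_lintegral_cubeAvg]
    _ ≤ (∫⁻ x, A ^ s * cubeMax (α / n) (cubeAvg p t h) x ^ s) ^ (1 / s) := by
        gcongr with x
        rw [← ENNReal.mul_rpow_of_nonneg _ _ hs0.le]
        gcongr
        exact hpoint t ht h hh x
    _ = (A ^ s * ∫⁻ x, cubeMax (α / n) (cubeAvg p t h) x ^ s) ^ (1 / s) := by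
        rw [lintegral_const_mul' _ _ (by finiteness)]
    _ ≤ (A ^ s * (B * (∫⁻ x, cubeAvg p t h x ^ q) ^ (s / q))) ^ (1 / s) := by
        gcongr
        exact hmax _ (measurable_cubeAvg ht.le hh)
    _ = K * sliceNorm p q t f := by
        rw [sliceNorm, sliceNormE_eq_lintegral_cubeAvg, ENNReal.mul_rpow_of_nonneg _ _ hs1,
          ENNReal.mul_rpow_of_nonneg _ _ hs1, ← ENNReal.rpow_mul, ← ENNReal.rpow_mul,
          mul_one_div_cancel hs0.ne', ENNReal.rpow_one, hK, ← mul_assoc]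
        congr 2
        field_simp
    _ ≤ ENNReal.ofReal (K.toReal + 1) * sliceNorm p q t f := by
        gcongr
        rw [← ENNReal.ofReal_toReal hKt]
        apply ENNReal.ofReal_le_ofReal
        rw [ENNReal.toReal_ofReal ENNReal.toReal_nonneg]
        linarith

end
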